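/- arXiv:quant-ph/0505036 — 2 statements merged into one kernel-verified Lean document; each statement's English description precedes it below -/
import Mathlib

section
/- Let S₁ and S₂ be stabiliser groups on N qubits and let ρ_i = 2^{−N} Σ_{g∈S_i} g be the corresponding stabiliser states. If there exists g ∈ S₁ with −g ∈ S₂, then Tr(ρ₁ ρ₂) = 0. If no such g exists, then Tr(ρ₁ ρ₂) = |S₁ ∩ S₂| / 2^N. -/
open Matrix
open scoped Kronecker

/-- The Pauli matrix `X`. -/
noncomputable def PauliX : Matrix (Fin 2) (Fin 2) ℂ := !![0, 1; 1, 0]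

/-- The Pauli matrix `Y`. -/
noncomputable def PauliY : Matrix (Fin 2) (Fin 2) ℂ := !![0, -Complex.I; Complex.I, 0]

/-- The Pauli matrix `Z`. -/
noncomputable def PauliZ : Matrix (Fin 2) (Fin 2) ℂ := !![1, 0; 0, -1]

/-- The Pauli string `σ 1 ⊗ ⋯ ⊗ σ N`, realised as a matrix indexed by
`Fin N → Fin 2` (the `N`-fold tensor product of `ℂ²`). -/
noncomputable def PString {N : ℕ} (σ : Fin N → Matrix (Fin 2) (Fin 2) ℂ) :
    Matrix (Fin N → Fin 2) (Fin N → Fin 2) ℂ :=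
  Matrix.of fun a b => ∏ i, σ i (a i) (b i)

/-- `S` is a stabiliser group on `N` qubits: a finite abelian group of signed Pauli
strings, not containing `-1`. -/
def IsStabiliserGroup {N : ℕ}
    (S : Finset (Matrix (Fin N → Fin 2) (Fin N → Fin 2) ℂ)) : Prop :=
  (1 : Matrix (Fin N → Fin 2) (Fin N → Fin 2) ℂ) ∈ S ∧
  (∀ g ∈ S, ∀ h ∈ S, g * h ∈ S) ∧
  (∀ g ∈ S, ∀ h ∈ S, g * h = h * g) ∧
  (∀ g ∈ S, ∃ (s : ℂ) (σ : Fin N → Matrix (Fin 2) (Fin 2) ℂ),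
    (s = 1 ∨ s = -1) ∧
    (∀ i, σ i ∈ ({1, PauliX, PauliY, PauliZ} : Set (Matrix (Fin 2) (Fin 2) ℂ))) ∧
    g = s • PString σ) ∧
  (-1 : Matrix (Fin N → Fin 2) (Fin N → Fin 2) ℂ) ∉ S

theorem PString_mul {N : ℕ} (σ τ : Fin N → Matrix (Fin 2) (Fin 2) ℂ) :
    PString σ * PString τ = PString fun i => σ i * τ i := by
  ext a b
  simp only [PString, Matrix.mul_apply, Matrix.of_apply, ← Finset.prod_mul_distrib]
  exact (Fintype.prod_sum fun i j => σ i (a i) j * τ i j (b i)).symm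

theorem trace_PString {N : ℕ} (σ : Fin N → Matrix (Fin 2) (Fin 2) ℂ) :
    (PString σ).trace = ∏ i, (σ i).trace := by
  simp only [Matrix.trace, Matrix.diag, PString, Matrix.of_apply]
  exact (Fintype.prod_sum fun i j => σ i j j).symm

theorem PString_one {N : ℕ} :
    PString (fun _ : Fin N => (1 : Matrix (Fin 2) (Fin 2) ℂ)) = 1 := by
  ext a b
  simp only [PString, Matrix.of_apply, Matrix.one_apply, Finset.prod_ite_zero,
    Finset.prod_const_one, funext_iff, Finset.mem_univ, true_implies]

theorem pauli_mul_self {σ : Matrix (Fin 2) (Fin 2) ℂ}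
    (hσ : σ ∈ ({1, PauliX, PauliY, PauliZ} : Set (Matrix (Fin 2) (Fin 2) ℂ))) :
    σ * σ = 1 := by
  rcases hσ with rfl | rfl | rfl | rfl <;>
    simp [PauliX, PauliY, PauliZ, Matrix.one_fin_two]

theorem trace_pauli_mul_of_ne {σ τ : Matrix (Fin 2) (Fin 2) ℂ}
    (hσ : σ ∈ ({1, PauliX, PauliY, PauliZ} : Set (Matrix (Fin 2) (Fin 2) ℂ)))
    (hτ : τ ∈ ({1, PauliX, PauliY, PauliZ} : Set (Matrix (Fin 2) (Fin 2) ℂ)))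
    (h : σ ≠ τ) : (σ * τ).trace = 0 := by
  rcases hσ with rfl | rfl | rfl | rfl <;> rcases hτ with rfl | rfl | rfl | rfl <;>
    first
    | exact absurd rfl h
    | simp [PauliX, PauliY, PauliZ, Matrix.trace_fin_two]

namespace IsStabiliserGroup

variable {N : ℕ} {S S₁ S₂ : Finset (Matrix (Fin N → Fin 2) (Fin N → Fin 2) ℂ)}
  {g h : Matrix (Fin N → Fin 2) (Fin N → Fin 2) ℂ}

theorem mul_self (hS : IsStabiliserGroup S) (hg : g ∈ S) : g * g = 1 := by
  obtain ⟨s, σ, hs, hσ, rfl⟩ := hS.2.2.2.1 g hg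
  have hss : s * s = 1 := by rcases hs with rfl | rfl <;> norm_num
  rw [smul_mul_smul_comm, hss, one_smul, PString_mul]
  simp only [pauli_mul_self (hσ _), PString_one]

theorem mul_sum (hS : IsStabiliserGroup S) (hg : g ∈ S) : g * ∑ x ∈ S, x = ∑ x ∈ S, x := by
  rw [Finset.mul_sum]
  refine Finset.sum_nbij' (g * ·) (g * ·) (fun x hx => hS.2.1 g hg x hx)
    (fun x hx => hS.2.1 g hg x hx) ?_ ?_ fun _ _ => rfl <;>
  · intro x _
    simp only [← mul_assoc, hS.mul_self hg, one_mul]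

theorem sum_mul (hS : IsStabiliserGroup S) (hg : g ∈ S) :
    (∑ x ∈ S, x) * g = ∑ x ∈ S, x := by
  rw [(Commute.sum_left S _ g fun x hx => hS.2.2.1 x hx g hg).eq, hS.mul_sum hg]

theorem trace_mul_of_ne (hS₁ : IsStabiliserGroup S₁) (hS₂ : IsStabiliserGroup S₂)
    (hg : g ∈ S₁) (hh : h ∈ S₂) (hne : g ≠ h) (hneg : -g ≠ h) : (g * h).trace = 0 := by
  obtain ⟨s, σ, hs, hσ, rfl⟩ := hS₁.2.2.2.1 g hg
  obtain ⟨t, τ, ht, hτ, rfl⟩ := hS₂.2.2.2.1 h hh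
  have hστ : σ ≠ τ := by
    rintro rfl
    rcases hs with rfl | rfl <;> rcases ht with rfl | rfl <;> simp at hne hneg
  obtain ⟨i, hi⟩ := Function.ne_iff.mp hστ
  rw [smul_mul_smul_comm, PString_mul, Matrix.trace_smul, trace_PString,
    Finset.prod_eq_zero (Finset.mem_univ i) (trace_pauli_mul_of_ne (hσ i) (hτ i) hi), smul_zero]

end IsStabiliserGroup

open scoped Classical in
/-- **Overlap of two stabiliser states.** For stabiliser states
`ρᵢ = 2^(-N) ∑_{g ∈ Sᵢ} g`: if some `g ∈ S₁` has `-g ∈ S₂` the overlap `Tr(ρ₁ρ₂)`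
vanishes; otherwise it equals `|S₁ ∩ S₂| / 2^N`. -/
theorem stmt14 (N : ℕ)
    (S₁ S₂ : Finset (Matrix (Fin N → Fin 2) (Fin N → Fin 2) ℂ))
    (hS₁ : IsStabiliserGroup S₁) (hS₂ : IsStabiliserGroup S₂)
    (ρ₁ ρ₂ : Matrix (Fin N → Fin 2) (Fin N → Fin 2) ℂ)
    (hρ₁ : ρ₁ = ((2 : ℂ) ^ N)⁻¹ • ∑ g ∈ S₁, g)
    (hρ₂ : ρ₂ = ((2 : ℂ) ^ N)⁻¹ • ∑ g ∈ S₂, g) :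
    ((∃ g ∈ S₁, -g ∈ S₂) → (ρ₁ * ρ₂).trace = 0) ∧
    ((¬ ∃ g ∈ S₁, -g ∈ S₂) →
      (ρ₁ * ρ₂).trace = ((S₁ ∩ S₂).card : ℂ) / (2 : ℂ) ^ N) := by
  subst hρ₁ hρ₂
  rw [smul_mul_smul_comm, Matrix.trace_smul, smul_eq_mul]
  refine ⟨?_, fun hno => ?_⟩
  · rintro ⟨g, hg, hg'⟩
    have key : (∑ x ∈ S₁, x) * ∑ x ∈ S₂, x = -((∑ x ∈ S₁, x) * ∑ x ∈ S₂, x) := by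
      conv_lhs => rw [← hS₁.sum_mul hg, ← hS₂.mul_sum hg']
      rw [mul_assoc, ← mul_assoc g, mul_neg, hS₁.mul_self hg, neg_mul, one_mul, mul_neg]
    have htrace := congrArg Matrix.trace key
    rw [Matrix.trace_neg] at htrace
    rw [self_eq_neg.mp htrace, mul_zero]
  · have htrace : ∀ g ∈ S₁, ∀ h ∈ S₂, (g * h).trace = if g = h then (2 : ℂ) ^ N else 0 := by
      intro g hg h hh
      split_ifs with hgh
      · rw [← hgh, hS₁.mul_self hg]
        simp
      · exact hS₁.trace_mul_of_ne hS₂ hg hh hgh fun e => hno ⟨g, hg, e ▸ hh⟩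
    have hsum : ((∑ x ∈ S₁, x) * ∑ x ∈ S₂, x).trace = ((S₁ ∩ S₂).card : ℂ) * 2 ^ N := by
      rw [Finset.sum_mul_sum, Matrix.trace_sum]
      simp_rw [Matrix.trace_sum]
      rw [Finset.sum_congr rfl fun g hg => Finset.sum_congr rfl fun h hh => htrace g hg h hh]
      simp [Finset.sum_ite_mem]
    rw [hsum]
    field_simp
end

section
/- Let s, t₁, t₂ ∈ {1, −1}, let σ₁ be a 2×2 complex matrix with X σ₁ = −σ₁ X, and let Q₁, Q₂, g₁′, g₂′ be arbitrary d × d complex matrices. Set A = (I₂ + sX)/2, P₁ = A ⊗ Q₁ and P₂ = ((I₂ ⊗ I_d + t₁ (σ₁ ⊗ g₁′))/2) · ((I₂ ⊗ I_d + t₂ (X ⊗ g₂′))/2) · (I₂ ⊗ Q₂). Then P₁ P₂ P₁ = (1/2) · A ⊗ ( Q₁ · ((I_d + s t₂ g₂′)/2) · Q₂ · Q₁ ). -/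
open Matrix
open scoped Kronecker

theorem PauliX_mul_self : PauliX * PauliX = 1 := by
  ext i j
  fin_cases i <;> fin_cases j <;> simp [PauliX, Matrix.mul_apply]

theorem PauliX_mul_proj {s : ℂ} (hs : s * s = 1) :
    PauliX * ((2⁻¹ : ℂ) • (1 + s • PauliX)) = s • ((2⁻¹ : ℂ) • (1 + s • PauliX)) := by
  simp only [mul_smul_comm, mul_add, mul_one, PauliX_mul_self, smul_add, smul_smul]
  rw [show s * (2⁻¹ * s) = (2⁻¹ : ℂ) by linear_combination (2⁻¹ : ℂ) * hs, mul_comm s, add_comm]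

theorem proj_mul_PauliX {s : ℂ} (hs : s * s = 1) :
    ((2⁻¹ : ℂ) • (1 + s • PauliX)) * PauliX = s • ((2⁻¹ : ℂ) • (1 + s • PauliX)) := by
  rw [← PauliX_mul_proj hs]
  simp only [smul_mul_assoc, mul_smul_comm, mul_add, add_mul, mul_one, one_mul]

theorem proj_mul_self {s : ℂ} (hs : s * s = 1) :
    ((2⁻¹ : ℂ) • (1 + s • PauliX)) * ((2⁻¹ : ℂ) • (1 + s • PauliX)) =
      (2⁻¹ : ℂ) • (1 + s • PauliX) := by
  nth_rewrite 1 [smul_mul_assoc]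
  rw [add_mul, one_mul, smul_mul_assoc, PauliX_mul_proj hs, smul_smul s s, hs, one_smul,
    ← two_smul ℂ, smul_smul]
  norm_num

theorem proj_mul_mul_proj_of_anticomm {s : ℂ} (hs : s * s = 1)
    {σ : Matrix (Fin 2) (Fin 2) ℂ} (hσ : PauliX * σ = -(σ * PauliX)) :
    ((2⁻¹ : ℂ) • (1 + s • PauliX)) * σ * ((2⁻¹ : ℂ) • (1 + s • PauliX)) = 0 := by
  set A := (2⁻¹ : ℂ) • (1 + s • PauliX) with hA
  have h : A * σ = (2⁻¹ : ℂ) • (σ - s • (σ * PauliX)) := by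
    rw [hA, smul_mul_assoc, add_mul, one_mul, smul_mul_assoc, hσ, smul_neg, sub_eq_add_neg]
  have hXA : PauliX * A = s • A := PauliX_mul_proj hs
  clear_value A
  rw [h, smul_mul_assoc, sub_mul, smul_mul_assoc, mul_assoc, hXA, mul_smul_comm,
    smul_smul, hs, one_smul, sub_self, smul_zero]

/-- **Overlap iteration step, case (c).** With `A = (I₂ + sX)/2`, `σ₁` anticommuting
with `X`, `P₁ = A ⊗ Q₁` and
`P₂ = ((I + t₁(σ₁ ⊗ g₁'))/2)((I + t₂(X ⊗ g₂'))/2)(I₂ ⊗ Q₂)`,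
`P₁ P₂ P₁ = (1/2) A ⊗ (Q₁ ((I + s t₂ g₂')/2) Q₂ Q₁)`. -/
theorem stmt18 (d : ℕ) (s t₁ t₂ : ℂ)
    (hs : s = 1 ∨ s = -1) (ht₁ : t₁ = 1 ∨ t₁ = -1) (ht₂ : t₂ = 1 ∨ t₂ = -1)
    (σ₁ : Matrix (Fin 2) (Fin 2) ℂ) (hσ₁ : PauliX * σ₁ = -(σ₁ * PauliX))
    (Q₁ Q₂ g₁' g₂' : Matrix (Fin d) (Fin d) ℂ)
    (A : Matrix (Fin 2) (Fin 2) ℂ) (hA : A = (2⁻¹ : ℂ) • (1 + s • PauliX))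
    (P₁ P₂ : Matrix (Fin 2 × Fin d) (Fin 2 × Fin d) ℂ)
    (hP₁ : P₁ = A ⊗ₖ Q₁)
    (hP₂ : P₂ = ((2⁻¹ : ℂ) •
        ((1 : Matrix (Fin 2) (Fin 2) ℂ) ⊗ₖ (1 : Matrix (Fin d) (Fin d) ℂ) +
          t₁ • (σ₁ ⊗ₖ g₁'))) *
      ((2⁻¹ : ℂ) •
        ((1 : Matrix (Fin 2) (Fin 2) ℂ) ⊗ₖ (1 : Matrix (Fin d) (Fin d) ℂ) +
          t₂ • (PauliX ⊗ₖ g₂'))) *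
      ((1 : Matrix (Fin 2) (Fin 2) ℂ) ⊗ₖ Q₂)) :
    P₁ * P₂ * P₁ =
      (2⁻¹ : ℂ) • (A ⊗ₖ (Q₁ * ((2⁻¹ : ℂ) • (1 + (s * t₂) • g₂')) * Q₂ * Q₁)) := by
  have hss : s * s = 1 := by rcases hs with rfl | rfl <;> norm_num
  have hAA : A * A = A := hA ▸ proj_mul_self hss
  have hXA : PauliX * A = s • A := hA ▸ PauliX_mul_proj hss
  have hAX : A * PauliX = s • A := hA ▸ proj_mul_PauliX hss
  have hAσA : A * σ₁ * A = 0 := hA ▸ proj_mul_mul_proj_of_anticomm hss hσ₁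
  have hAσXA : A * (σ₁ * PauliX) * A = 0 := by
    rw [mul_assoc, mul_assoc, hXA, mul_smul_comm, mul_smul_comm, ← mul_assoc, hAσA, smul_zero]
  clear hA
  subst hP₁ hP₂
  simp only [mul_add, add_mul, smul_mul_assoc, mul_smul_comm, ← mul_kronecker_mul, mul_one,
    one_mul, hAA, hAX, hAσA, hAσXA, zero_kronecker, smul_zero, add_zero, smul_add,
    kronecker_add, smul_kronecker, kronecker_smul, smul_smul, mul_assoc]
  congr 2
  ring
end
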